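/- Let G = ⟨s₁,…,s_r⟩ be the free group of rank r and G ↷ᵀ (X,B,μ) a G-system. Let P be the set of finite-entropy partitions of X equipped with the Rohlin distance d. Then the functions α ↦ F(T,α) and α ↦ F_*(T,α) are continuous on P, and the functions α ↦ f(T,α) and α ↦ f_*(T,α) are upper semi-continuous on P. -/

import Mathlib

open MeasureTheory Filter
open scoped ENNReal symmDiff

namespace Bowen

noncomputable section

/-- The free group of rank `r`. -/
abbrev FG (r : ℕ) := FreeGroup (Fin r)

/-- The generating set element corresponding to `(i, b)`: `sᵢ` if `b = true`,
`sᵢ⁻¹` if `b = false`. -/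
def gen {r : ℕ} (s : Fin r × Bool) : FG r :=
  cond s.2 (FreeGroup.of s.1) (FreeGroup.of s.1)⁻¹

/-- The symmetric generating set `S = {s₁^{±1},…,s_r^{±1}}`. -/
def Sset (r : ℕ) : Set (FG r) := Set.range (gen (r := r))

/-- The ball of radius `n` about the identity in the word metric of `(G,S)`. -/
def ball (r n : ℕ) : Set (FG r) := {g | FreeGroup.norm g ≤ n}

section Partitions

variable {X : Type*} [mX : MeasurableSpace X] {K L : Type*}

/-- Shannon entropy of the countable labeled partition `p` with respect to `μ`
(in `ℝ≥0∞`, so that `H(p) < ∞` is meaningful). -/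
def Hpart (μ : Measure X) (p : X → K) : ℝ≥0∞ :=
  ∑' k : K, ENNReal.ofReal (Real.negMulLog ((μ (p ⁻¹' {k})).toReal))

/-- The atom of the partition `p` containing `x`. -/
def atomOf (p : X → K) (x : X) : Set X := p ⁻¹' {p x}

/-- Conditional Shannon entropy of `p` given the sub-σ-algebra `m`:
`H(p|m) = ∫ -log( μ(A_x | m)(x) ) dμ(x)`. -/
def HpartC (μ : Measure X) (p : X → K) (m : MeasurableSpace X) : ℝ≥0∞ :=
  ∫⁻ x, ENNReal.ofReal
    (- Real.log ((μ[(atomOf p x).indicator (fun _ => (1:ℝ)) | m]) x)) ∂μ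

/-- Join of two labeled partitions. -/
def pjoin (p : X → K) (q : X → L) : X → K × L := fun x => (p x, q x)

/-- Pullback partition `T_g^{-1} p`. -/
def pull {r : ℕ} (T : FG r → X → X) (g : FG r) (p : X → K) : X → K :=
  fun x => p (T g x)

/-- The join `⋁_{q ∈ Q} T_q^{-1} p` over a set `Q ⊆ G`. -/
def powS {r : ℕ} (T : FG r → X → X) (p : X → K) (Q : Set (FG r)) : X → (Q → K) :=
  fun x q => p (T (q : FG r) x)

/-- The join `p^n = ⋁_{g ∈ B(e,n)} T_g^{-1} p`. -/
def pow {r : ℕ} (T : FG r → X → X) (p : X → K) (n : ℕ) : X → (ball r n → K) :=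
  powS T p (ball r n)

/-- The σ-algebra generated by the partition `p`. -/
def sAlg (p : X → K) : MeasurableSpace X := MeasurableSpace.comap p ⊤

/-- The smallest `G`-invariant σ-algebra containing the partition `p`. -/
def sAlgG {r : ℕ} (T : FG r → X → X) (p : X → K) : MeasurableSpace X :=
  ⨆ g : FG r, sAlg (pull T g p)

/-- The σ-algebra `⋁_{f ∈ Q} T_f^{-1} p` for a (possibly infinite) `Q ⊆ G`. -/
def sAlgSet {r : ℕ} (T : FG r → X → X) (p : X → K) (Q : Set (FG r)) :
    MeasurableSpace X :=
  ⨆ f ∈ Q, sAlg (pull T f p)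

/-- `F(T,α) = (1−2r)H(α) + ∑ᵢ H(α ∨ T_{sᵢ}^{-1}α)`. -/
def FF {r : ℕ} (T : FG r → X → X) (μ : Measure X) (p : X → K) : ℝ :=
  (1 - 2 * (r : ℝ)) * (Hpart μ p).toReal
    + ∑ i : Fin r, (Hpart μ (pjoin p (pull T (FreeGroup.of i) p))).toReal

/-- `f(T,α) = inf_{n>0} F(T,α^n)`, as an extended real. -/
def littleF {r : ℕ} (T : FG r → X → X) (μ : Measure X) (p : X → K) : EReal :=
  ⨅ n : ℕ, ((FF T μ (pow T p (n + 1)) : ℝ) : EReal)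

/-- Conditional version `F(T,α|𝓕) = (1−2r)H(α|𝓕) + ∑ᵢ H(α ∨ T_{sᵢ}^{-1}α|𝓕)`. -/
def FFc {r : ℕ} (T : FG r → X → X) (μ : Measure X) (m : MeasurableSpace X)
    (p : X → K) : ℝ :=
  (1 - 2 * (r : ℝ)) * (HpartC (mX := mX) μ p m).toReal
    + ∑ i : Fin r, (HpartC (mX := mX) μ (pjoin p (pull T (FreeGroup.of i) p)) m).toReal

/-- Conditional `f(T,α|𝓕) = inf_{n>0} F(T,α^n|𝓕)`. -/
def littleFc {r : ℕ} (T : FG r → X → X) (μ : Measure X) (m : MeasurableSpace X)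
    (p : X → K) : EReal :=
  ⨅ n : ℕ, ((FFc (mX := mX) T μ m (pow T p (n + 1)) : ℝ) : EReal)

/-- The mean entropy `h(T_s, α) = lim_n H(⋁_{i=0}^n T_s^{-i}α)/(n+1)`; since the
sequence is subadditive the limit equals the infimum, which we take as the
definition. -/
def hrate {r : ℕ} (T : FG r → X → X) (μ : Measure X) (s : FG r) (p : X → K) : ℝ :=
  ⨅ n : ℕ, (Hpart μ (fun x (i : Fin (n + 1)) => p (T (s ^ (i : ℕ)) x))).toReal / (n + 1)

/-- Conditional mean entropy `h(T_s, α|𝓕) = lim_n H(⋁_{i=0}^n T_s^{-i}α | 𝓕)/(n+1)`;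
for an invariant `𝓕` the sequence is subadditive so the limit equals the infimum. -/
def hrateC {r : ℕ} (T : FG r → X → X) (μ : Measure X) (m : MeasurableSpace X)
    (s : FG r) (p : X → K) : ℝ :=
  ⨅ n : ℕ, (HpartC (mX := mX) μ (fun x (i : Fin (n + 1)) => p (T (s ^ (i : ℕ)) x)) m).toReal / (n + 1)

/-- `F_*(T,α) = (1−r)H(α) + ∑ᵢ h(T_{sᵢ},α)`. -/
def Fstar {r : ℕ} (T : FG r → X → X) (μ : Measure X) (p : X → K) : ℝ :=
  (1 - (r : ℝ)) * (Hpart μ p).toReal + ∑ i : Fin r, hrate T μ (FreeGroup.of i) p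

/-- `f_*(T,α) = inf_{n>0} F_*(T,α^n)`. -/
def fstar {r : ℕ} (T : FG r → X → X) (μ : Measure X) (p : X → K) : EReal :=
  ⨅ n : ℕ, ((Fstar T μ (pow T p (n + 1)) : ℝ) : EReal)

/-- `F_*(T,α|𝓕) = (1−r)H(α|𝓕) + ∑ᵢ h(T_{sᵢ},α|𝓕)`. -/
def FstarC {r : ℕ} (T : FG r → X → X) (μ : Measure X) (m : MeasurableSpace X)
    (p : X → K) : ℝ :=
  (1 - (r : ℝ)) * (HpartC (mX := mX) μ p m).toReal + ∑ i : Fin r, hrateC (mX := mX) T μ m (FreeGroup.of i) p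

/-- `f_*(T,α|𝓕) = inf_{n>0} F_*(T,α^n|𝓕)`. -/
def fstarC {r : ℕ} (T : FG r → X → X) (μ : Measure X) (m : MeasurableSpace X)
    (p : X → K) : EReal :=
  ⨅ n : ℕ, ((FstarC (mX := mX) T μ m (pow T p (n + 1)) : ℝ) : EReal)

/-- `p` refines `q`: each atom of `p` is contained, up to a `μ`-null set,
in an atom of `q`. -/
def Refines (μ : Measure X) (p : X → K) (q : X → L) : Prop :=
  ∀ k : K, ∃ l : L, μ (p ⁻¹' {k} \ q ⁻¹' {l}) = 0

/-- Two labeled partitions are equal as partitions (up to null sets). -/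
def PartEquiv (μ : Measure X) (p : X → K) (q : X → L) : Prop :=
  Refines μ p q ∧ Refines μ q p

/-- `σ` is a simple splitting of `p`: `σ = p ∨ T_s^{-1}β` for some `s ∈ S` and
some coarsening `β` of `p`. -/
def SimpleSplit {r : ℕ} (μ : Measure X) (T : FG r → X → X) (p σ : X → ℕ) : Prop :=
  ∃ s ∈ Sset r, ∃ β : X → ℕ, Measurable β ∧ Refines μ p β ∧
    PartEquiv μ σ (pjoin p (pull T s β))

/-- `τ` is a splitting of `p`: obtained from `p` by a finite sequence of simple
splittings (as a partition, i.e. up to relabeling and null sets). -/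
def IsSplitting {r : ℕ} (μ : Measure X) (T : FG r → X → X) (p : X → ℕ)
    (τ : X → K) : Prop :=
  ∃ σ : X → ℕ, Relation.ReflTransGen (SimpleSplit μ T) p σ ∧ PartEquiv μ σ τ

/-- A partition is generating if the smallest `G`-invariant σ-algebra containing it
is the full σ-algebra up to `μ`-null sets. -/
def Generating {r : ℕ} (T : FG r → X → X) (μ : Measure X) (p : X → K) : Prop :=
  ∀ A : Set X, MeasurableSet A →
    ∃ A' : Set X, MeasurableSet[sAlgG T p] A' ∧ μ (A ∆ A') = 0

/-- The Rohlin distance `d(α,β) = H(α|β) + H(β|α)`. -/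
def rohlinDist (μ : Measure X) (p : X → K) (q : X → L) : ℝ :=
  (HpartC μ p (sAlg q)).toReal + (HpartC μ q (sAlg p)).toReal

end Partitions

/-- Adjacency in the left Cayley graph `Γ_L`: an edge joins `a` and `sa`, `s ∈ S`. -/
def adjL {r : ℕ} (a b : FG r) : Prop := ∃ s ∈ Sset r, b = s * a

/-- `Past(g₁;g₂)`: the set of `f ∈ G` such that every path in the left Cayley
graph from `f` to `g₁` passes through `g₂`. -/
def Past {r : ℕ} (g₁ g₂ : FG r) : Set (FG r) :=
  {f | ∀ l : List (FG r), l ≠ [] → l.head? = some f → l.getLast? = some g₁ →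
        l.Chain' adjL → g₂ ∈ l}

/-- A subset `F ⊆ G` is right-connected: the subgraph of the right Cayley graph
induced on `F` is connected. -/
def RightConnected {r : ℕ} (F : Set (FG r)) : Prop :=
  ∀ g ∈ F, ∀ h ∈ F,
    Relation.ReflTransGen (fun a b => a ∈ F ∧ b ∈ F ∧ ∃ s ∈ Sset r, b = a * s) g h

/-- A subset `F ⊆ G` is left-connected: the subgraph of the left Cayley graph
induced on `F` is connected. -/
def LeftConnected {r : ℕ} (F : Set (FG r)) : Prop :=
  ∀ g ∈ F, ∀ h ∈ F,
    Relation.ReflTransGen (fun a b => a ∈ F ∧ b ∈ F ∧ ∃ s ∈ Sset r, b = s * a) g h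

section Markov

variable {X : Type*} [MeasurableSpace X] {K : Type*}

/-- A `G`-process `(T,X,μ,α)` is Markov: for every `s ∈ S`, `g ∈ G` and every atom
`A` of `α`, `μ(T_{sg}^{-1}A | ⋁_{f∈Past(sg;g)} T_f^{-1}α) = μ(T_{sg}^{-1}A | T_g^{-1}α)`
almost everywhere. -/
def IsMarkov {r : ℕ} (μ : Measure X) (T : FG r → X → X) (p : X → K) : Prop :=
  ∀ s ∈ Sset r, ∀ g : FG r, ∀ k : K,
    (μ[((pull T (s * g) p) ⁻¹' {k}).indicator (fun _ => (1:ℝ)) |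
        sAlgSet T p (Past (s * g) g)])
      =ᵐ[μ]
    (μ[((pull T (s * g) p) ⁻¹' {k}).indicator (fun _ => (1:ℝ)) |
        sAlg (pull T g p)])

end Markov


section ExtraDefs

/-- The distance `d₁` between two ordered processes:
`∑_{s∈S} ∑_{i,j} |μ(A_i ∩ T_s^{-1}A_j) − ν(B_i ∩ U_s^{-1}B_j)|`. -/
def d1 {X Y : Type*} [MeasurableSpace X] [MeasurableSpace Y] {r : ℕ}
    (T : FG r → X → X) (μ : Measure X) (α : X → ℕ)
    (U : FG r → Y → Y) (ν : Measure Y) (β : Y → ℕ) : ℝ :=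
  ∑ i : Fin r, ∑ b : Bool,
    ∑' ij : ℕ × ℕ,
      |(μ (α ⁻¹' {ij.1} ∩ pull T (gen (i, b)) α ⁻¹' {ij.2})).toReal -
        (ν (β ⁻¹' {ij.1} ∩ pull U (gen (i, b)) β ⁻¹' {ij.2})).toReal|

/-- Isomorphism of ordered processes: a measure conjugacy between conull sets
intertwining the actions and carrying the `i`-th atom to the `i`-th atom. -/
def OrderedIso {X Y : Type*} [MeasurableSpace X] [MeasurableSpace Y] {r : ℕ}
    (T : FG r → X → X) (μ : Measure X) (α : X → ℕ)
    (U : FG r → Y → Y) (ν : Measure Y) (β : Y → ℕ) : Prop :=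
  ∃ (X' : Set X) (Y' : Set Y) (φ : X → Y) (ψ : Y → X),
    MeasurableSet X' ∧ MeasurableSet Y' ∧ μ X'ᶜ = 0 ∧ ν Y'ᶜ = 0 ∧
    Measurable φ ∧ Measurable ψ ∧ Set.MapsTo φ X' Y' ∧ Set.MapsTo ψ Y' X' ∧
    (∀ x ∈ X', ψ (φ x) = x) ∧ (∀ y ∈ Y', φ (ψ y) = y) ∧
    Measure.map φ μ = ν ∧
    (∀ (g : FG r), ∀ x ∈ X', φ (T g x) = U g (φ x)) ∧
    (∀ x ∈ X', β (φ x) = α x)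

/-- A transition system for `(G,S)`: a family of `K × K` matrices indexed by the
generating set together with a row vector, written as functions. -/
structure TransSys (r : ℕ) (K : Type*) where
  P : Fin r × Bool → K → K → ℝ
  pi : K → ℝ

/-- The transition system is an invariant transition system: the `P^s` are
stochastic matrices, `π` is a probability vector which is a steady state vector
for every `P^s`, and `π_i P^{s^{-1}}_{ij} = π_j P^s_{ji}`. -/
def TransSys.IsInvariant {r : ℕ} {K : Type*} (ts : TransSys r K) : Prop :=
  (∀ s i j, 0 ≤ ts.P s i j) ∧ (∀ s i, HasSum (ts.P s i) 1) ∧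
    (∀ i, 0 ≤ ts.pi i) ∧ HasSum ts.pi 1 ∧
    (∀ s j, HasSum (fun i => ts.pi i * ts.P s i j) (ts.pi j)) ∧
    (∀ s i j, ts.pi i * ts.P (s.1, !s.2) i j = ts.pi j * ts.P s j i)

/-- The canonical (shift) action of `G` on `K^G`: `(T_g x)(f) = x(fg)`. -/
def shiftT {r : ℕ} {K : Type*} : FG r → (FG r → K) → (FG r → K) :=
  fun g x f => x (f * g)

/-- `μ` is (a measure) induced by the transition system `ts`: the time-`e`
distribution is `π` and the transition probabilities into the complement of the
past are given by the matrices `P^s`.  (Note `T_g^{-1}A_k = {x : x(g) = k}`;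
the conditional equalities `μ(A|B) = c` are recorded in the equivalent product
form `μ(A ∩ B) = c·μ(B)`.) -/
def IsInducedBy {r : ℕ} {K : Type*} [MeasurableSpace K]
    (μ : Measure (FG r → K)) (ts : TransSys r K) : Prop :=
  (∀ k : K, μ {x | x 1 = k} = ENNReal.ofReal (ts.pi k)) ∧
  ∀ (s : Fin r × Bool) (g : FG r),
    FreeGroup.norm (gen s * g) = FreeGroup.norm g + 1 →
    ∀ (n : ℕ) (fs : Fin n → FG r) (ks : Fin n → K) (k₀ k : K),
      (∀ i, fs i ∈ Past (gen s * g) g ∧ fs i ≠ g) →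
      (μ ({x | x (gen s * g) = k} ∩ ({x | x g = k₀} ∩ ⋂ i, {x | x (fs i) = ks i}))
          = ENNReal.ofReal (ts.P s k₀ k) * μ ({x | x g = k₀} ∩ ⋂ i, {x | x (fs i) = ks i})) ∧
      μ ({x | x (gen s * g) = k} ∩ {x | x g = k₀})
          = ENNReal.ofReal (ts.P s k₀ k) * μ {x | x g = k₀}

end ExtraDefs

section Aux

variable {X : Type*} [MeasurableSpace X] {K L M : Type*}

/-- Every label set has measurable preimage. -/
def PM (p : X → K) : Prop := ∀ s : Set K, MeasurableSet (p ⁻¹' s)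

lemma PM.join [Countable K] [Countable L] {p : X → K} {q : X → L} (hp : PM p) (hq : PM q) :
    PM (pjoin p q) := by
  intro s
  have : pjoin p q ⁻¹' s = ⋃ k ∈ s, (p ⁻¹' {k.1} ∩ q ⁻¹' {k.2}) := by
    ext x; simp [pjoin]
  rw [this]
  exact MeasurableSet.biUnion (Set.to_countable s) (fun k _ => (hp _).inter (hq _))

lemma PM.comp {p : X → K} (hp : PM p) (f : K → L) : PM (fun x => f (p x)) :=
  fun s => hp (f ⁻¹' s)

lemma lintegral_label [Countable K] (μ : Measure X) {p : X → K} (hp : PM p) (g : K → ℝ≥0∞) :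
    ∫⁻ x, g (p x) ∂μ = ∑' k, g k * μ (p ⁻¹' {k}) := by
  letI : MeasurableSpace K := ⊤
  have hm : Measurable p := fun s _ => hp s
  have h1 : ∫⁻ x, g (p x) ∂μ = ∫⁻ k, g k ∂(μ.map p) :=
    (lintegral_map (measurable_of_countable g) hm).symm
  rw [h1, lintegral_countable']
  refine tsum_congr fun k => ?_
  rw [Measure.map_apply hm (MeasurableSet.singleton k)]

lemma tsum_label [Countable K] (μ : Measure X) {p : X → K} (hp : PM p) {A : Set X}
    (hA : MeasurableSet A) :
    ∑' k, μ (p ⁻¹' {k} ∩ A) = μ A := by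
  have := lintegral_label (μ.restrict A) hp (fun _ => 1)
  simp only [lintegral_const, one_mul, Measure.restrict_apply MeasurableSet.univ,
    Set.univ_inter] at this
  rw [this]
  exact tsum_congr fun k => (Measure.restrict_apply (hp _)).symm

/-- Almost every point lies in an atom of positive measure. -/
lemma ae_pos [Countable K] (μ : Measure X) {p : X → K} :
    ∀ᵐ x ∂μ, μ (atomOf p x) ≠ 0 := by
  rw [ae_iff]
  have : {x | ¬ μ (atomOf p x) ≠ 0} ⊆ ⋃ k ∈ {k : K | μ (p ⁻¹' {k}) = 0}, p ⁻¹' {k} := by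
    intro x hx
    simp only [ne_eq, not_not, Set.mem_setOf_eq] at hx
    simp only [Set.mem_iUnion]
    exact ⟨p x, hx, rfl⟩
  refine measure_mono_null this ?_
  rw [measure_biUnion_null_iff (Set.to_countable _)]
  intro k hk; exact hk

/-- Information function. -/
def info (μ : Measure X) (p : X → K) (x : X) : ℝ≥0∞ :=
  ENNReal.ofReal (- Real.log (μ (atomOf p x)).toReal)

lemma Hpart_eq [Countable K] (μ : Measure X) [IsProbabilityMeasure μ] {p : X → K} (hp : PM p) :
    Hpart μ p = ∫⁻ x, info μ p x ∂μ := by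
  have := lintegral_label μ hp (fun k => ENNReal.ofReal (- Real.log (μ (p ⁻¹' {k})).toReal))
  unfold info atomOf
  rw [this, Hpart]
  refine tsum_congr fun k => ?_
  conv_rhs => rw [← ENNReal.ofReal_toReal (measure_ne_top μ (p ⁻¹' {k}))]
  rw [ENNReal.toReal_ofReal ENNReal.toReal_nonneg, mul_comm,
    ← ENNReal.ofReal_mul ENNReal.toReal_nonneg, Real.negMulLog]
  congr 1; ring

lemma info_measurable [Countable K] (μ : Measure X) {p : X → K} (hp : PM p) :
    Measurable (info μ p) := by
  letI : MeasurableSpace K := ⊤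
  have hm : Measurable p := fun s _ => hp s
  exact (measurable_of_countable
    (fun k : K => ENNReal.ofReal (- Real.log (μ (p ⁻¹' {k})).toReal))).comp hm

lemma Hpart_mono [Countable K] [Countable L] (μ : Measure X) [IsProbabilityMeasure μ]
    {p : X → K} {q : X → L} (hp : PM p) (hq : PM q) (h : ∀ x y, q x = q y → p x = p y) :
    Hpart μ p ≤ Hpart μ q := by
  rw [Hpart_eq μ hp, Hpart_eq μ hq]
  refine lintegral_mono_ae ?_
  filter_upwards [ae_pos μ (p := q)] with x hx
  have hsub : atomOf q x ⊆ atomOf p x := fun y hy => h _ _ hy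
  refine ENNReal.ofReal_le_ofReal (neg_le_neg (Real.log_le_log ?_ ?_))
  · exact ENNReal.toReal_pos hx (measure_ne_top _ _)
  · exact ENNReal.toReal_mono (measure_ne_top _ _) (measure_mono hsub)

lemma Hpart_congr [Countable K] [Countable L] (μ : Measure X) [IsProbabilityMeasure μ]
    {p : X → K} {q : X → L} (hp : PM p) (hq : PM q) (h : ∀ x y, q x = q y ↔ p x = p y) :
    Hpart μ p = Hpart μ q :=
  le_antisymm (Hpart_mono μ hp hq fun x y => (h x y).1)
    (Hpart_mono μ hq hp fun x y => (h x y).2)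

lemma real_ineq {a b c d : ℝ} (ha : 0 < a) (hb : 0 < b) (hc : 0 < c) (hd : 0 < d)
    (ha1 : a ≤ 1) (hb1 : b ≤ 1) (hc1 : c ≤ 1) (hd1 : d ≤ 1) :
    ENNReal.ofReal (-Real.log c) + ENNReal.ofReal (-Real.log d) + 1 ≤
      ENNReal.ofReal (-Real.log a) + ENNReal.ofReal (-Real.log b)
        + ENNReal.ofReal (a * b / (c * d)) := by
  have h : ∀ {t : ℝ}, 0 < t → t ≤ 1 → 0 ≤ -Real.log t := fun h0 h1 =>
    neg_nonneg.2 (Real.log_nonpos h0.le h1)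
  rw [← ENNReal.ofReal_one, ← ENNReal.ofReal_add (h hc hc1) (h hd hd1),
    ← ENNReal.ofReal_add (add_nonneg (h hc hc1) (h hd hd1)) zero_le_one,
    ← ENNReal.ofReal_add (h ha ha1) (h hb hb1),
    ← ENNReal.ofReal_add (add_nonneg (h ha ha1) (h hb hb1)) (by positivity)]
  refine ENNReal.ofReal_le_ofReal ?_
  have := Real.log_le_sub_one_of_pos (show 0 < a * b / (c * d) by positivity)
  rw [Real.log_div (by positivity) (by positivity), Real.log_mul ha.ne' hb.ne',
    Real.log_mul hc.ne' hd.ne'] at this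
  linarith

lemma ratio_le [Countable K] [Countable L] [Countable M] (μ : Measure X) [IsProbabilityMeasure μ]
    {p : X → K} {q : X → L} {z : X → M} (hp : PM p) (hq : PM q) (hz : PM z) :
    ∫⁻ x, μ (atomOf (pjoin p z) x) * μ (atomOf (pjoin q z) x) /
      (μ (atomOf (pjoin p (pjoin q z)) x) * μ (atomOf z x)) ∂μ ≤ 1 := by
  have hw : PM (pjoin z (pjoin p q)) := hz.join (hp.join hq)
  have h1 := lintegral_label μ hw (fun w => μ (p ⁻¹' {w.2.1} ∩ z ⁻¹' {w.1}) *
    μ (q ⁻¹' {w.2.2} ∩ z ⁻¹' {w.1}) /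
    (μ (p ⁻¹' {w.2.1} ∩ (q ⁻¹' {w.2.2} ∩ z ⁻¹' {w.1})) * μ (z ⁻¹' {w.1})))
  have h2 : ∀ x, μ (atomOf (pjoin p z) x) * μ (atomOf (pjoin q z) x) /
      (μ (atomOf (pjoin p (pjoin q z)) x) * μ (atomOf z x)) =
      (fun w : M × K × L => μ (p ⁻¹' {w.2.1} ∩ z ⁻¹' {w.1}) *
    μ (q ⁻¹' {w.2.2} ∩ z ⁻¹' {w.1}) /
    (μ (p ⁻¹' {w.2.1} ∩ (q ⁻¹' {w.2.2} ∩ z ⁻¹' {w.1})) * μ (z ⁻¹' {w.1})))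
      (pjoin z (pjoin p q) x) := by
    intro x
    have e3 : atomOf (pjoin p z) x = p ⁻¹' {p x} ∩ z ⁻¹' {z x} := by
      ext y; simp [atomOf, pjoin]
    have e4 : atomOf (pjoin q z) x = q ⁻¹' {q x} ∩ z ⁻¹' {z x} := by
      ext y; simp [atomOf, pjoin]
    have e5 : atomOf (pjoin p (pjoin q z)) x
        = p ⁻¹' {p x} ∩ (q ⁻¹' {q x} ∩ z ⁻¹' {z x}) := by
      ext y; simp [atomOf, pjoin]
    rw [e3, e4, e5]; rfl
  rw [lintegral_congr h2, h1, ENNReal.tsum_prod']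
  calc _ ≤ ∑' m : M, ∑' kl : K × L, μ (p ⁻¹' {kl.1} ∩ z ⁻¹' {m}) *
          μ (q ⁻¹' {kl.2} ∩ z ⁻¹' {m}) * (μ (z ⁻¹' {m}))⁻¹ := by
        refine ENNReal.tsum_le_tsum fun m => ENNReal.tsum_le_tsum fun kl => ?_
        have e6 : pjoin z (pjoin p q) ⁻¹' {(m, kl)}
          = p ⁻¹' {kl.1} ∩ (q ⁻¹' {kl.2} ∩ z ⁻¹' {m}) := by
          ext y; simp [pjoin, Prod.ext_iff]; tauto
        rw [e6]
        simp only
        set c := μ (p ⁻¹' {kl.1} ∩ (q ⁻¹' {kl.2} ∩ z ⁻¹' {m}))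
        rcases eq_or_ne c 0 with hc | hc
        · rw [hc]; simp
        · have hct : c ≠ ⊤ := measure_ne_top _ _
          rw [div_eq_mul_inv, ENNReal.mul_inv (Or.inl hc) (Or.inl hct), mul_assoc]
          gcongr
          rw [mul_comm c⁻¹, mul_assoc, ENNReal.inv_mul_cancel hc hct, mul_one]
    _ ≤ ∑' m : M, μ (z ⁻¹' {m}) := by
        refine ENNReal.tsum_le_tsum fun m => ?_
        rw [ENNReal.tsum_mul_right, ENNReal.tsum_prod']
        simp only [ENNReal.tsum_mul_left, ENNReal.tsum_mul_right]
        rw [tsum_label μ hp (hz _), tsum_label μ hq (hz _), mul_assoc]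
        refine (mul_le_mul' le_rfl (ENNReal.mul_inv_le_one _)).trans (by rw [mul_one])
    _ = 1 := by
        have := tsum_label μ hz MeasurableSet.univ
        simpa using this

lemma Hpart_submod [Countable K] [Countable L] [Countable M] (μ : Measure X)
    [IsProbabilityMeasure μ]
    {p : X → K} {q : X → L} {z : X → M} (hp : PM p) (hq : PM q) (hz : PM z) :
    Hpart μ (pjoin p (pjoin q z)) + Hpart μ z ≤ Hpart μ (pjoin p z) + Hpart μ (pjoin q z) := by
  have hpz := hp.join hz
  have hqz := hq.join hz
  have hpqz := hp.join hqz
  have key : Hpart μ (pjoin p (pjoin q z)) + Hpart μ z + 1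
      ≤ Hpart μ (pjoin p z) + Hpart μ (pjoin q z) + 1 := by
    refine le_trans ?_ (add_le_add le_rfl (ratio_le μ hp hq hz))
    rw [Hpart_eq μ hpz, Hpart_eq μ hqz, Hpart_eq μ hpqz, Hpart_eq μ hz]
    have h1 : (1 : ℝ≥0∞) = ∫⁻ _, 1 ∂μ := by simp
    rw [← lintegral_add_left (info_measurable μ hpqz), h1,
      ← lintegral_add_right _ measurable_const,
      ← lintegral_add_left (info_measurable μ hpz),
      ← lintegral_add_left (f := fun a => info μ (pjoin p z) a + info μ (pjoin q z) a)
        ((info_measurable μ hpz).add (info_measurable μ hqz))]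
    refine lintegral_mono_ae ?_
    filter_upwards [ae_pos μ (p := pjoin p (pjoin q z))] with x hx
    have mono : ∀ {A : Set X}, atomOf (pjoin p (pjoin q z)) x ⊆ A → 0 < (μ A).toReal :=
      fun h => ENNReal.toReal_pos (fun h0 => hx (measure_mono_null h h0)) (measure_ne_top _ _)
    have ha := mono (A := atomOf (pjoin p z) x) (fun y hy => by
      simp [atomOf, pjoin] at hy ⊢; tauto)
    have hb := mono (A := atomOf (pjoin q z) x) (fun y hy => by
      simp [atomOf, pjoin] at hy ⊢; tauto)
    have hc := mono (A := atomOf (pjoin p (pjoin q z)) x) le_rfl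
    have hd := mono (A := atomOf z x) (fun y hy => by
      simp [atomOf, pjoin] at hy ⊢; tauto)
    have le1 : ∀ A : Set X, (μ A).toReal ≤ 1 := fun A => by
      simpa using ENNReal.toReal_mono ENNReal.one_ne_top (prob_le_one (μ := μ) (s := A))
    refine (real_ineq ha hb hc hd (le1 _) (le1 _) (le1 _) (le1 _)).trans ?_
    refine add_le_add le_rfl (le_of_eq ?_)
    rw [ENNReal.ofReal_div_of_pos (by positivity), ENNReal.ofReal_mul ha.le,
      ENNReal.ofReal_mul hc.le]
    simp only [ENNReal.ofReal_toReal (measure_ne_top _ _)]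
  exact (ENNReal.add_le_add_iff_right ENNReal.one_ne_top).1 key

lemma Hpart_sub [Countable K] [Countable L] (μ : Measure X) [IsProbabilityMeasure μ]
    {p : X → K} {q : X → L} (hp : PM p) (hq : PM q) :
    Hpart μ (pjoin p q) ≤ Hpart μ p + Hpart μ q := by
  have hz : PM (fun _ : X => ()) := fun s => MeasurableSet.const _
  have := Hpart_submod μ hp hq hz
  rw [Hpart_congr μ (hp.join (hq.join hz)) (hp.join hq) (by simp [pjoin]),
    Hpart_congr μ (hp.join hz) hp (by simp [pjoin]),
    Hpart_congr μ (hq.join hz) hq (by simp [pjoin])] at this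
  exact le_trans le_self_add this

/-- Chain rule. -/
lemma HpartC_chain [Countable K] [Countable L] (μ : Measure X) [IsProbabilityMeasure μ]
    {p : X → K} {q : X → L} (hp : PM p) (hq : PM q) :
    HpartC μ p (sAlg q) + Hpart μ q = Hpart μ (pjoin p q) := by
  have hm : sAlg q ≤ ‹MeasurableSpace X› := by
    rintro s ⟨t, -, rfl⟩; exact hq t
  have hce : ∀ᵐ x ∂μ, ∀ k, (μ[(p ⁻¹' {k}).indicator (fun _ => (1:ℝ)) | sAlg q]) x
      = (μ (p ⁻¹' {k} ∩ atomOf q x)).toReal / (μ (atomOf q x)).toReal := by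
    rw [ae_all_iff]
    intro k
    filter_upwards [ae_pos μ (p := q)] with x hx
    set f := μ[(p ⁻¹' {k}).indicator (fun _ => (1:ℝ)) | sAlg q] with hf
    have hfm : Measurable[sAlg q] f := stronglyMeasurable_condExp.measurable
    have hat : MeasurableSet[sAlg q] (atomOf q x) := ⟨{q x}, trivial, rfl⟩
    have hconst : ∀ y ∈ atomOf q x, f y = f x := by
      intro y hy
      obtain ⟨t, -, ht⟩ := hfm (measurableSet_singleton (f x))
      have hx' : x ∈ q ⁻¹' t := by rw [ht]; rfl
      have hy' : y ∈ q ⁻¹' t := by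
        have : q y = q x := hy
        rw [Set.mem_preimage, this]; exact hx'
      rw [ht] at hy'
      exact hy'
    have hint : Integrable ((p ⁻¹' {k}).indicator (fun _ => (1:ℝ))) μ :=
      (integrable_const 1).indicator (hp _)
    have h1 : ∫ y in atomOf q x, f y ∂μ
        = ∫ y in atomOf q x, (p ⁻¹' {k}).indicator (fun _ => (1:ℝ)) y ∂μ :=
      setIntegral_condExp hm hint hat
    rw [setIntegral_congr_fun (hm _ hat) hconst] at h1
    rw [integral_indicator (hp _), Measure.restrict_restrict (hp _)] at h1
    simp [Measure.real] at h1
    have hpos := ENNReal.toReal_pos hx (measure_ne_top _ _)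
    rw [eq_div_iff hpos.ne', mul_comm]
    exact h1
  rw [Hpart_eq μ hq, Hpart_eq μ (hp.join hq), HpartC,
    ← lintegral_add_right _ (info_measurable μ hq)]
  refine lintegral_congr_ae ?_
  filter_upwards [hce, ae_pos μ (p := pjoin p q)] with x hx hpos
  have e3 : atomOf (pjoin p q) x = p ⁻¹' {p x} ∩ atomOf q x := by
    ext y; simp [atomOf, pjoin]
  have hsub : atomOf (pjoin p q) x ⊆ atomOf q x := by rw [e3]; exact Set.inter_subset_right
  have h1 := ENNReal.toReal_pos hpos (measure_ne_top _ _)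
  have h12 : (μ (atomOf (pjoin p q) x)).toReal ≤ (μ (atomOf q x)).toReal :=
    ENNReal.toReal_mono (measure_ne_top _ _) (measure_mono hsub)
  have h2 := h1.trans_le h12
  have h3 : (μ (atomOf q x)).toReal ≤ 1 := by
    simpa using ENNReal.toReal_mono ENNReal.one_ne_top (prob_le_one (μ := μ) (s := atomOf q x))
  have hl := Real.log_le_log h1 h12
  show ENNReal.ofReal (-Real.log ((μ[(p ⁻¹' {p x}).indicator (fun _ => (1:ℝ)) | sAlg q]) x))
    + info μ q x = info μ (pjoin p q) x
  rw [hx, ← e3, info, info, Real.log_div h1.ne' h2.ne',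
    ← ENNReal.ofReal_add (by linarith) (neg_nonneg.2 (Real.log_nonpos h2.le h3))]
  congr 1; ring

/-- Measurable with finite entropy. -/
def Good (μ : Measure X) (p : X → K) : Prop := PM p ∧ Hpart μ p ≠ ⊤

lemma Good.join [Countable K] [Countable L] {μ : Measure X} [IsProbabilityMeasure μ]
    {p : X → K} {q : X → L} (hp : Good μ p) (hq : Good μ q) : Good μ (pjoin p q) :=
  ⟨hp.1.join hq.1, ne_top_of_le_ne_top (ENNReal.add_ne_top.2 ⟨hp.2, hq.2⟩)
    (Hpart_sub μ hp.1 hq.1)⟩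

/-- Real valued entropy. -/
def Hr (μ : Measure X) (p : X → K) : ℝ := (Hpart μ p).toReal

lemma Hr_mono [Countable K] [Countable L] {μ : Measure X} [IsProbabilityMeasure μ]
    {p : X → K} {q : X → L} (hp : PM p) (hq : Good μ q) (h : ∀ x y, q x = q y → p x = p y) :
    Hr μ p ≤ Hr μ q :=
  ENNReal.toReal_mono hq.2 (Hpart_mono μ hp hq.1 h)

lemma Hr_congr [Countable K] [Countable L] {μ : Measure X} [IsProbabilityMeasure μ]
    {p : X → K} {q : X → L} (hp : PM p) (hq : PM q) (h : ∀ x y, q x = q y ↔ p x = p y) :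
    Hr μ p = Hr μ q := by
  rw [Hr, Hr, Hpart_congr μ hp hq h]

lemma Hr_submod [Countable K] [Countable L] [Countable M] {μ : Measure X}
    [IsProbabilityMeasure μ]
    {p : X → K} {q : X → L} {z : X → M} (hp : Good μ p) (hq : Good μ q) (hz : Good μ z) :
    Hr μ (pjoin p (pjoin q z)) + Hr μ z ≤ Hr μ (pjoin p z) + Hr μ (pjoin q z) := by
  have := Hpart_submod μ hp.1 hq.1 hz.1
  have h2 := ENNReal.toReal_mono
    (ENNReal.add_ne_top.2 ⟨(hp.join hz).2, (hq.join hz).2⟩) this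
  rwa [ENNReal.toReal_add (hp.join (hq.join hz)).2 hz.2,
    ENNReal.toReal_add (hp.join hz).2 (hq.join hz).2] at h2

/-- Real form of the Rohlin distance. -/
def DD (μ : Measure X) (p : X → K) (q : X → L) : ℝ :=
  2 * Hr μ (pjoin p q) - Hr μ p - Hr μ q

lemma rohlin_eq [Countable K] [Countable L] {μ : Measure X} [IsProbabilityMeasure μ]
    {p : X → K} {q : X → L} (hp : Good μ p) (hq : Good μ q) : rohlinDist μ p q = DD μ p q := by
  have h1 := HpartC_chain μ hp.1 hq.1
  have h2 := HpartC_chain μ hq.1 hp.1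
  have h3 : Hpart μ (pjoin q p) = Hpart μ (pjoin p q) :=
    Hpart_congr μ (hq.join hp).1 (hp.join hq).1 (by simp [pjoin]; tauto)
  have f1 : HpartC μ p (sAlg q) ≠ ⊤ :=
    ne_top_of_le_ne_top (hp.join hq).2 (h1 ▸ le_self_add)
  have f2 : HpartC μ q (sAlg p) ≠ ⊤ :=
    ne_top_of_le_ne_top (hq.join hp).2 (h2 ▸ le_self_add)
  have g1 := congrArg ENNReal.toReal h1
  have g2 := congrArg ENNReal.toReal h2
  rw [ENNReal.toReal_add f1 hq.2] at g1
  rw [ENNReal.toReal_add f2 hp.2, h3] at g2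
  unfold rohlinDist DD Hr
  linarith

lemma abs_Hr_sub_le [Countable K] [Countable L] {μ : Measure X} [IsProbabilityMeasure μ]
    {p : X → K} {q : X → L} (hp : Good μ p) (hq : Good μ q) : |Hr μ p - Hr μ q| ≤ DD μ p q := by
  have h1 := Hr_mono hp.1 (hp.join hq) (by simp [pjoin]; tauto)
  have h2 := Hr_mono hq.1 (hp.join hq) (by simp [pjoin])
  rw [abs_le]; unfold DD; constructor <;> linarith

lemma DD_join {K' L' : Type*} [Countable K] [Countable L] [Countable K'] [Countable L']
    {μ : Measure X} [IsProbabilityMeasure μ]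
    {p : X → K} {q : X → L} {p' : X → K'} {q' : X → L'}
    (hp : Good μ p) (hq : Good μ q) (hp' : Good μ p') (hq' : Good μ q') :
    DD μ (pjoin p p') (pjoin q q') ≤ DD μ p q + DD μ p' q' := by
  have a1 := Hr_submod hp hp' (hq.join hq')
  have a2 := Hr_submod hp hq' hq
  have a3 := Hr_submod hp' hq hq'
  have b1 := Hr_submod hq hq' (hp.join hp')
  have b2 := Hr_submod hq hp' hp
  have b3 := Hr_submod hq' hp hp'
  have c1 : Hr μ (pjoin p (pjoin p' (pjoin q q'))) = Hr μ (pjoin (pjoin p p') (pjoin q q')) :=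
    Hr_congr (hp.join (hp'.join (hq.join hq'))).1 ((hp.join hp').join (hq.join hq')).1
      (by simp [pjoin]; tauto)
  have c2 : Hr μ (pjoin q (pjoin q' (pjoin p p'))) = Hr μ (pjoin (pjoin p p') (pjoin q q')) :=
    Hr_congr (hq.join (hq'.join (hp.join hp'))).1 ((hp.join hp').join (hq.join hq')).1
      (by simp [pjoin]; tauto)
  have c3 : Hr μ (pjoin p (pjoin q' q)) = Hr μ (pjoin p (pjoin q q')) :=
    Hr_congr (hp.join (hq'.join hq)).1 (hp.join (hq.join hq')).1 (by simp [pjoin]; tauto)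
  have c4 : Hr μ (pjoin q (pjoin p' p)) = Hr μ (pjoin q (pjoin p p')) :=
    Hr_congr (hq.join (hp'.join hp)).1 (hq.join (hp.join hp')).1 (by simp [pjoin]; tauto)
  have c5 : Hr μ (pjoin q p) = Hr μ (pjoin p q) :=
    Hr_congr (hq.join hp).1 (hp.join hq).1 (by simp [pjoin]; tauto)
  have c6 : Hr μ (pjoin q' p') = Hr μ (pjoin p' q') :=
    Hr_congr (hq'.join hp').1 (hp'.join hq').1 (by simp [pjoin]; tauto)
  have c7 : Hr μ (pjoin q' q) = Hr μ (pjoin q q') :=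
    Hr_congr (hq'.join hq).1 (hq.join hq').1 (by simp [pjoin]; tauto)
  have c8 : Hr μ (pjoin p' p) = Hr μ (pjoin p p') :=
    Hr_congr (hp'.join hp).1 (hp.join hp').1 (by simp [pjoin]; tauto)
  unfold DD
  linarith

lemma PM.fam {ι : Type*} [Finite ι] [Countable K] {p : ι → X → K} (hp : ∀ i, PM (p i)) :
    PM (fun x i => p i x) := by
  intro s
  have : (fun x i => p i x) ⁻¹' s = ⋃ k ∈ s, ⋂ i, p i ⁻¹' {k i} := by
    ext x
    simp only [Set.mem_preimage, Set.mem_iUnion, Set.mem_iInter, Set.mem_singleton_iff,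
      exists_prop]
    constructor
    · intro h; exact ⟨_, h, fun i => rfl⟩
    · rintro ⟨k, hk, h⟩
      rwa [show (fun i => p i x) = k from funext h]
  rw [this]
  exact MeasurableSet.biUnion (Set.to_countable s)
    (fun k _ => MeasurableSet.iInter fun i => hp i _)

lemma Hpart_const {μ : Measure X} [IsProbabilityMeasure μ] {p : X → K} [Countable K] (hp : PM p)
    (h : ∀ x y, p x = p y) : Hpart μ p = 0 := by
  have hz : PM (fun _ : X => ()) := fun s => MeasurableSet.const _
  rw [Hpart_congr μ hp hz (by simpa using h)]
  simp [Hpart]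

lemma fam_aux {ι : Type*} [Countable K] {μ : Measure X} [IsProbabilityMeasure μ]
    {p q : ι → X → K} (hp : ∀ i, Good μ (p i)) (hq : ∀ i, Good μ (q i)) (s : Finset ι) :
    Good μ (fun x (i : s) => p i x) ∧ Good μ (fun x (i : s) => q i x) ∧
    DD μ (fun x (i : s) => p i x) (fun x (i : s) => q i x) ≤ ∑ i ∈ s, DD μ (p i) (q i) := by
  classical
  have gp : ∀ s : Finset ι, PM (fun x (i : s) => p i x) := fun s => PM.fam fun i => (hp i).1
  have gq : ∀ s : Finset ι, PM (fun x (i : s) => q i x) := fun s => PM.fam fun i => (hq i).1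
  induction s using Finset.induction_on with
  | empty =>
    have h1 := Hpart_const (μ := μ) (gp ∅) (fun x y => Subsingleton.elim _ _)
    have h2 := Hpart_const (μ := μ) (gq ∅) (fun x y => Subsingleton.elim _ _)
    have h3 := Hpart_const (μ := μ) ((gp ∅).join (gq ∅)) (fun x y => Subsingleton.elim _ _)
    refine ⟨⟨gp _, by rw [h1]; simp⟩, ⟨gq _, by rw [h2]; simp⟩, ?_⟩
    rw [DD, Hr, Hr, Hr, h1, h2, h3]
    simp
  | insert a s ha ih =>
    obtain ⟨i1, i2, i3⟩ := ih
    have j1 := (hp a).join i1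
    have j2 := (hq a).join i2
    have e : ∀ (u : ι → X → K) (x y : X), (pjoin (u a) (fun x (i : s) => u i x) x
        = pjoin (u a) (fun x (i : s) => u i x) y) ↔
        ((fun (i : (insert a s : Finset ι)) => u i x) =
          fun (i : (insert a s : Finset ι)) => u i y) := by
      intro u x y
      simp only [pjoin, Prod.mk.injEq, funext_iff, Subtype.forall, Finset.mem_insert]
      constructor
      · rintro ⟨h1, h2⟩ i (rfl | hi)
        · exact h1
        · exact h2 i hi
      · intro h
        exact ⟨h a (Or.inl rfl), fun i hi => h i (Or.inr hi)⟩
    have k1 := Hpart_congr μ (gp (insert a s)) j1.1 (e p)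
    have k2 := Hpart_congr μ (gq (insert a s)) j2.1 (e q)
    have k3 := Hpart_congr μ ((gp (insert a s)).join (gq (insert a s))) (j1.join j2).1
      (fun x y => by
        have e1 := e p x y
        have e2 := e q x y
        refine Prod.mk.injEq _ _ _ _ ▸ ?_
        exact (and_congr e1 e2).trans (by simp [pjoin]))
    refine ⟨⟨gp _, by rw [k1]; exact j1.2⟩, ⟨gq _, by rw [k2]; exact j2.2⟩, ?_⟩
    rw [Finset.sum_insert ha]
    refine le_trans (le_of_eq ?_) ((DD_join (hp a) (hq a) i1 i2).trans (by linarith))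
    rw [DD, DD, Hr, Hr, Hr, Hr, Hr, Hr, k1, k2, k3]

lemma fam_main {ι : Type*} [Fintype ι] [Countable K] {μ : Measure X} [IsProbabilityMeasure μ]
    {p q : ι → X → K} (hp : ∀ i, Good μ (p i)) (hq : ∀ i, Good μ (q i)) :
    Good μ (fun x i => p i x) ∧ Good μ (fun x i => q i x) ∧
    DD μ (fun x i => p i x) (fun x i => q i x) ≤ ∑ i, DD μ (p i) (q i) := by
  obtain ⟨i1, i2, i3⟩ := fam_aux hp hq Finset.univ
  have gp : PM (fun x i => p i x) := PM.fam fun i => (hp i).1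
  have gq : PM (fun x i => q i x) := PM.fam fun i => (hq i).1
  have k1 := Hpart_congr μ gp i1.1 (by simp [funext_iff])
  have k2 := Hpart_congr μ gq i2.1 (by simp [funext_iff])
  have k3 := Hpart_congr μ (gp.join gq) (i1.join i2).1 (by simp [funext_iff, pjoin])
  refine ⟨⟨gp, by rw [k1]; exact i1.2⟩, ⟨gq, by rw [k2]; exact i2.2⟩, ?_⟩
  refine le_trans (le_of_eq ?_) i3
  rw [DD, DD, Hr, Hr, Hr, Hr, Hr, Hr, k1, k2, k3]

section Action

variable {r : ℕ} {T : FG r → X → X} {μ : Measure X} [IsProbabilityMeasure μ]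

lemma Hpart_pull (hT : ∀ g : FG r, MeasurePreserving (T g) μ μ) (g : FG r) {p : X → K}
    (hp : PM p) : Hpart μ (pull T g p) = Hpart μ p := by
  refine tsum_congr fun k => ?_
  rw [show pull T g p ⁻¹' {k} = T g ⁻¹' (p ⁻¹' {k}) from rfl,
    (hT g).measure_preimage (hp _).nullMeasurableSet]

lemma Good.pull (hT : ∀ g : FG r, MeasurePreserving (T g) μ μ) (g : FG r) {p : X → K}
    (hp : Good μ p) : Good μ (pull T g p) :=
  ⟨fun s => (hT g).measurable (hp.1 s), by rw [Hpart_pull hT g hp.1]; exact hp.2⟩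

lemma DD_pull [Countable K] [Countable L] (hT : ∀ g : FG r, MeasurePreserving (T g) μ μ)
    (g : FG r) {p : X → K} {q : X → L}
    (hp : PM p) (hq : PM q) : DD μ (pull T g p) (pull T g q) = DD μ p q := by
  have h := Hpart_pull hT g (hp.join hq)
  rw [DD, DD, Hr, Hr, Hr, Hr, Hr, Hr, Hpart_pull hT g hp, Hpart_pull hT g hq, ← h]
  rfl

lemma FF_lip [Countable K] (hT : ∀ g : FG r, MeasurePreserving (T g) μ μ) {p q : X → K}
    (hp : Good μ p) (hq : Good μ q) :
    |FF T μ p - FF T μ q| ≤ (|1 - 2 * (r : ℝ)| + 2 * r) * DD μ p q := by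
  have h0 := abs_Hr_sub_le hp hq
  have h1 : ∀ i : Fin r, |Hr μ (pjoin p (pull T (FreeGroup.of i) p))
      - Hr μ (pjoin q (pull T (FreeGroup.of i) q))| ≤ 2 * DD μ p q := by
    intro i
    have hp' := hp.pull hT (FreeGroup.of i)
    have hq' := hq.pull hT (FreeGroup.of i)
    have := (abs_Hr_sub_le (hp.join hp') (hq.join hq')).trans (DD_join hp hq hp' hq')
    rw [DD_pull hT _ hp.1 hq.1] at this
    linarith
  have e : FF T μ p - FF T μ q = (1 - 2 * (r : ℝ)) * (Hr μ p - Hr μ q) +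
      ∑ i : Fin r, (Hr μ (pjoin p (pull T (FreeGroup.of i) p))
      - Hr μ (pjoin q (pull T (FreeGroup.of i) q))) := by
    rw [Finset.sum_sub_distrib]; unfold FF Hr; ring
  rw [e]
  refine (abs_add_le _ _).trans ?_
  rw [abs_mul]
  have h2 := (Finset.abs_sum_le_sum_abs (fun i : Fin r =>
    (Hr μ (pjoin p (pull T (FreeGroup.of i) p))
      - Hr μ (pjoin q (pull T (FreeGroup.of i) q)))) Finset.univ).trans
      (Finset.sum_le_sum fun i _ => h1 i)
  have h3 := mul_le_mul_of_nonneg_left h0 (abs_nonneg (1 - 2 * (r : ℝ)))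
  simp only [Finset.sum_const, Finset.card_univ, Fintype.card_fin, nsmul_eq_mul] at h2
  linarith

lemma ciInf_lip {a b : ℕ → ℝ} {d : ℝ} (ha : ∀ n, 0 ≤ a n)
    (h : ∀ n, |a n - b n| ≤ d) : (⨅ n, a n) - d ≤ ⨅ n, b n := by
  refine le_ciInf fun n => ?_
  have h1 : (⨅ n, a n) ≤ a n := ciInf_le ⟨0, by rintro _ ⟨n, rfl⟩; exact ha n⟩ n
  have h2 := (abs_le.1 (h n)).2
  linarith

lemma hrate_lip [Countable K] (hT : ∀ g : FG r, MeasurePreserving (T g) μ μ) (s : FG r)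
    {p q : X → K} (hp : Good μ p) (hq : Good μ q) :
    |hrate T μ s p - hrate T μ s q| ≤ DD μ p q := by
  have key : ∀ n : ℕ,
      |(Hpart μ (fun x (i : Fin (n + 1)) => p (T (s ^ (i : ℕ)) x))).toReal / (n + 1)
      - (Hpart μ (fun x (i : Fin (n + 1)) => q (T (s ^ (i : ℕ)) x))).toReal / (n + 1)|
      ≤ DD μ p q := by
    intro n
    obtain ⟨g1, g2, g3⟩ := fam_main (μ := μ)
      (p := fun i : Fin (n + 1) => pull T (s ^ (i : ℕ)) p)
      (q := fun i : Fin (n + 1) => pull T (s ^ (i : ℕ)) q)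
      (fun i => hp.pull hT _) (fun i => hq.pull hT _)
    have h := (abs_Hr_sub_le g1 g2).trans g3
    simp only [DD_pull hT _ hp.1 hq.1, Finset.sum_const, Finset.card_univ, Fintype.card_fin,
      nsmul_eq_mul] at h
    push_cast at h
    have hn : (0 : ℝ) < n + 1 := by positivity
    rw [← sub_div, abs_div, abs_of_pos hn, div_le_iff₀ hn, mul_comm]
    exact h
  have n1 : ∀ (u : X → K) (n : ℕ),
      0 ≤ (Hpart μ (fun x (i : Fin (n + 1)) => u (T (s ^ (i : ℕ)) x))).toReal / (n + 1) :=
    fun u n => by positivity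
  have k1 := ciInf_lip (n1 p) key
  have k2 := ciInf_lip (n1 q) (fun n => by rw [abs_sub_comm]; exact key n)
  unfold hrate
  rw [abs_le]; constructor <;> linarith

lemma Fstar_lip [Countable K] (hT : ∀ g : FG r, MeasurePreserving (T g) μ μ) {p q : X → K}
    (hp : Good μ p) (hq : Good μ q) :
    |Fstar T μ p - Fstar T μ q| ≤ (|1 - (r : ℝ)| + r) * DD μ p q := by
  have h0 := abs_Hr_sub_le hp hq
  have e : Fstar T μ p - Fstar T μ q = (1 - (r : ℝ)) * (Hr μ p - Hr μ q) +
      ∑ i : Fin r, (hrate T μ (FreeGroup.of i) p - hrate T μ (FreeGroup.of i) q) := by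
    rw [Finset.sum_sub_distrib]; unfold Fstar Hr; ring
  rw [e]
  refine (abs_add_le _ _).trans ?_
  rw [abs_mul]
  have h2 := (Finset.abs_sum_le_sum_abs (fun i : Fin r =>
    (hrate T μ (FreeGroup.of i) p - hrate T μ (FreeGroup.of i) q)) Finset.univ).trans
      (Finset.sum_le_sum fun i _ => hrate_lip hT (FreeGroup.of i) hp hq)
  have h3 := mul_le_mul_of_nonneg_left h0 (abs_nonneg (1 - (r : ℝ)))
  simp only [Finset.sum_const, Finset.card_univ, Fintype.card_fin, nsmul_eq_mul] at h2
  linarith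

lemma ball_finite (r n : ℕ) : (ball r n).Finite := by
  have h := List.finite_length_le (Fin r × Bool) n
  refine (h.preimage (f := FreeGroup.toWord) FreeGroup.toWord_injective.injOn).subset ?_
  intro g hg
  exact hg

instance ball_fin_inst (r n : ℕ) : Finite (ball r n) := ball_finite r n

lemma pow_lip [Countable K] (hT : ∀ g : FG r, MeasurePreserving (T g) μ μ) (n : ℕ) :
    ∃ N : ℝ, 0 ≤ N ∧ ∀ p q : X → K, Good μ p → Good μ q →
      Good μ (pow T p n) ∧ Good μ (pow T q n) ∧
      DD μ (pow T p n) (pow T q n) ≤ N * DD μ p q := by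
  haveI : Fintype (ball r n) := Fintype.ofFinite _
  refine ⟨Fintype.card (ball r n), by positivity, fun p q hp hq => ?_⟩
  obtain ⟨g1, g2, g3⟩ := fam_main (μ := μ)
    (p := fun i : ball r n => pull T (i : FG r) p)
    (q := fun i : ball r n => pull T (i : FG r) q)
    (fun i => hp.pull hT _) (fun i => hq.pull hT _)
  refine ⟨g1, g2, ?_⟩
  simp only [DD_pull hT _ hp.1 hq.1, Finset.sum_const, Finset.card_univ, nsmul_eq_mul] at g3
  exact g3

lemma usc_aux (Φ : ℕ → (X → ℕ) → ℝ) (C : ℕ → ℝ) (hC : ∀ n, 0 ≤ C n)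
    (h : ∀ n p q, Good μ p → Good μ q → |Φ n p - Φ n q| ≤ C n * DD μ p q)
    {α : X → ℕ} (hα : Good μ α) (c : EReal) (hc : (⨅ n, ((Φ n α : ℝ) : EReal)) < c) :
    ∃ δ : ℝ, 0 < δ ∧ ∀ β : X → ℕ, Good μ β → rohlinDist μ α β < δ →
      (⨅ n, ((Φ n β : ℝ) : EReal)) < c := by
  obtain ⟨n, hn⟩ := iInf_lt_iff.1 hc
  obtain ⟨c', h1, h2⟩ := EReal.lt_iff_exists_real_btwn.1 hn
  have h1' : Φ n α < c' := by exact_mod_cast h1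
  have hC1 : 0 < C n + 1 := by linarith [hC n]
  refine ⟨(c' - Φ n α) / (C n + 1), div_pos (by linarith) hC1, fun β hβ hd => ?_⟩
  rw [rohlin_eq hα hβ, lt_div_iff₀ hC1] at hd
  have h3 := (abs_le.1 (h n α β hα hβ)).1
  have h4 : 0 ≤ DD μ α β := (abs_nonneg _).trans (abs_Hr_sub_le hα hβ)
  have h5 : Φ n β < c' := by nlinarith
  exact (iInf_le _ n).trans_lt (lt_trans (by exact_mod_cast h5) h2)

end Action

end Aux

/-- on the space of finite-entropy partitions with the Rohlin
distance, `F` and `F_*` are continuous, and `f` and `f_*` are upper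
semi-continuous. -/
theorem stmt_6 {r : ℕ} (hr : 1 ≤ r) {X : Type*} [MeasurableSpace X] [StandardBorelSpace X]
    (μ : Measure X) [IsProbabilityMeasure μ]
    (T : FG r → X → X) (hT1 : T 1 = id)
    (hTmul : ∀ g h : FG r, T (g * h) = T g ∘ T h)
    (hTmp : ∀ g : FG r, MeasurePreserving (T g) μ μ)
    :
    (∀ (α : X → ℕ), Measurable α → Hpart μ α < ⊤ → ∀ ε : ℝ, 0 < ε → ∃ δ : ℝ, 0 < δ ∧
        ∀ (β : X → ℕ), Measurable β → Hpart μ β < ⊤ → rohlinDist μ α β < δ →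
          |FF T μ α - FF T μ β| < ε ∧ |Fstar T μ α - Fstar T μ β| < ε) ∧
    (∀ (α : X → ℕ), Measurable α → Hpart μ α < ⊤ → ∀ c : EReal, littleF T μ α < c →
        ∃ δ : ℝ, 0 < δ ∧ ∀ (β : X → ℕ), Measurable β → Hpart μ β < ⊤ →
          rohlinDist μ α β < δ → littleF T μ β < c) ∧
    (∀ (α : X → ℕ), Measurable α → Hpart μ α < ⊤ → ∀ c : EReal, fstar T μ α < c →
        ∃ δ : ℝ, 0 < δ ∧ ∀ (β : X → ℕ), Measurable β → Hpart μ β < ⊤ →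
          rohlinDist μ α β < δ → fstar T μ β < c) := by
  have G : ∀ α : X → ℕ, Measurable α → Hpart μ α < ⊤ → Good μ α := fun α h1 h2 =>
    ⟨fun s => h1 (MeasurableSet.of_discrete), h2.ne⟩
  choose N hN0 hN using fun n : ℕ => pow_lip (K := ℕ) (μ := μ) hTmp (n + 1)
  refine ⟨?_, ?_, ?_⟩
  · intro α h1 h2 ε hε
    have hα := G α h1 h2
    set C1 := |1 - 2 * (r : ℝ)| + 2 * r with hC1
    set C2 := |1 - (r : ℝ)| + r with hC2
    have p1 : 0 ≤ C1 := by positivity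
    have p2 : 0 ≤ C2 := by positivity
    have hpos : 0 < C1 + C2 + 1 := by linarith
    refine ⟨ε / (C1 + C2 + 1), div_pos hε hpos, fun β h3 h4 hd => ?_⟩
    have hβ := G β h3 h4
    rw [rohlin_eq hα hβ, lt_div_iff₀ hpos] at hd
    have h0 : 0 ≤ DD μ α β := (abs_nonneg _).trans (abs_Hr_sub_le hα hβ)
    have l1 := FF_lip hTmp hα hβ
    have l2 := Fstar_lip hTmp hα hβ
    rw [← hC1] at l1
    rw [← hC2] at l2
    have m1 := mul_nonneg p1 h0
    have m2 := mul_nonneg p2 h0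
    constructor <;> nlinarith
  · intro α h1 h2 c hc
    obtain ⟨δ, hδ, h⟩ := usc_aux (μ := μ) (fun n p => FF T μ (pow T p (n + 1)))
      (fun n => (|1 - 2 * (r : ℝ)| + 2 * r) * N n)
      (fun n => mul_nonneg (by positivity) (hN0 n))
      (fun n p q hp hq => by
        obtain ⟨a, b, d⟩ := hN n p q hp hq
        refine (FF_lip hTmp a b).trans ?_
        rw [mul_assoc]
        exact mul_le_mul_of_nonneg_left d (by positivity)) (G α h1 h2) c hc
    exact ⟨δ, hδ, fun β h3 h4 hd => h β (G β h3 h4) hd⟩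
  · intro α h1 h2 c hc
    obtain ⟨δ, hδ, h⟩ := usc_aux (μ := μ) (fun n p => Fstar T μ (pow T p (n + 1)))
      (fun n => (|1 - (r : ℝ)| + r) * N n)
      (fun n => mul_nonneg (by positivity) (hN0 n))
      (fun n p q hp hq => by
        obtain ⟨a, b, d⟩ := hN n p q hp hq
        refine (Fstar_lip hTmp a b).trans ?_
        rw [mul_assoc]
        exact mul_le_mul_of_nonneg_left d (by positivity)) (G α h1 h2) c hc
    exact ⟨δ, hδ, fun β h3 h4 hd => h β (G β h3 h4) hd⟩

end

end Bowen
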